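/- Let k be an algebraically closed field, d ≥ 3, and let f = x·w·∏_{i=1}^{d−2}(aᵢx+bᵢy+cᵢz+dᵢw) + y·z·∏_{i=1}^{d−2}(eᵢx+fᵢy+gᵢz+hᵢw) define a smooth surface S = V(f) ⊆ P³. Assume that the 2d linear forms x, w, a₁x+b₁y+c₁z+d₁w, …, a_{d−2}x+b_{d−2}y+c_{d−2}z+d_{d−2}w, y, z, e₁x+f₁y+g₁z+h₁w, …, e_{d−2}x+f_{d−2}y+g_{d−2}z+h_{d−2}w are pairwise non-proportional, and that the d² lines obtained by intersecting a plane from the first family {V(x), V(w), V(aᵢx+bᵢy+cᵢz+dᵢw)} with a plane from the second family {V(y), V(z), V(eᵢx+fᵢy+gᵢz+hᵢw)} are pairwise distinct (so they form a numerical star chord pair configuration on S). Then none of the coefficients aᵢ, dᵢ, fᵢ, gᵢ is zero, for any i = 1, …, d−2. -/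

import Mathlib

open MvPolynomial

/-- `W` is a line (2-dimensional linear subspace of `k⁴`) lying on the surface `V(f) ⊆ P³`. -/
def IsLineOn {k : Type*} [Field k] (f : MvPolynomial (Fin 4) k)
    (W : Submodule k (Fin 4 → k)) : Prop :=
  Module.finrank k W = 2 ∧ ∀ v ∈ W, MvPolynomial.eval v f = 0

/-- `f` is a nonzero homogeneous polynomial of degree `d` in `k[x,y,z,w]` such that `f` and its
four partial derivatives have no common zero in `k⁴ ∖ {0}`; i.e. `V(f) ⊆ P³` is a smooth
surface of degree `d`. -/
def IsSmoothSurface {k : Type*} [Field k] (f : MvPolynomial (Fin 4) k) (d : ℕ) : Prop :=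
  f ≠ 0 ∧ f.IsHomogeneous d ∧
    ∀ v : Fin 4 → k, v ≠ 0 →
      ¬ (MvPolynomial.eval v f = 0 ∧
         ∀ i : Fin 4, MvPolynomial.eval v (MvPolynomial.pderiv i f) = 0)

/-- The family of `n + 2` linear forms (given by their coefficient vectors)
`a, b, ℓ₁, …, ℓ_n`. -/
def famOf {k : Type*} [Field k] {n : ℕ} (a b : Fin 4 → k)
    (ℓ : Fin n → Fin 4 → k) : Fin (n + 2) → Fin 4 → k := fun i =>
  if h0 : (i : ℕ) = 0 then a
  else if h1 : (i : ℕ) = 1 then b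
  else ℓ ⟨(i : ℕ) - 2, by have := i.isLt; omega⟩

/-- The plane (3-dimensional subspace of `k⁴`) cut out by the linear form with
coefficient vector `coef`. -/
def planeOf {k : Type*} [Field k] (coef : Fin 4 → k) : Submodule k (Fin 4 → k) :=
  LinearMap.ker (∑ j, coef j • LinearMap.proj j : (Fin 4 → k) →ₗ[k] k)

/-- A smooth surface `V(A * P + C * D * Q)` has no point at which `A`, `P`, `C`, `D` all
vanish. -/
lemma IsSmoothSurface.eval_ne_zero {k : Type*} [Field k] {d : ℕ}
    {f A P C D Q : MvPolynomial (Fin 4) k} (hf : IsSmoothSurface f d)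
    (h : f = A * P + C * D * Q) {v : Fin 4 → k} (hv : v ≠ 0)
    (hA : eval v A = 0) (hC : eval v C = 0) (hD : eval v D = 0) : eval v P ≠ 0 := by
  intro hP
  refine hf.2.2 v hv ⟨?_, fun i => ?_⟩
  · simp [h, hA, hC]
  · simp [h, hA, hP, hC, hD]

theorem nsc_normal_form_coeffs_nonzero {k : Type*} [Field k] [IsAlgClosed k]
    (d : ℕ) (hd : 3 ≤ d)
    (ca cb cc cd ce cf cg ch : Fin (d - 2) → k)
    (f : MvPolynomial (Fin 4) k)
    (hfdef : f =
      X 0 * X 3 * (∏ i, (C (ca i) * X 0 + C (cb i) * X 1 + C (cc i) * X 2 + C (cd i) * X 3)) +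
      X 1 * X 2 * (∏ i, (C (ce i) * X 0 + C (cf i) * X 1 + C (cg i) * X 2 + C (ch i) * X 3)))
    (hf : IsSmoothSurface f d)
    (F₁ F₂ : Fin (d - 2 + 2) → Fin 4 → k)
    (hF₁ : F₁ = famOf (Pi.single 0 1) (Pi.single 3 1) fun i => ![ca i, cb i, cc i, cd i])
    (hF₂ : F₂ = famOf (Pi.single 1 1) (Pi.single 2 1) fun i => ![ce i, cf i, cg i, ch i])
    (hprop : ∀ a b : Fin (d - 2 + 2) ⊕ Fin (d - 2 + 2), a ≠ b → ∀ t : k,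
      Sum.elim F₁ F₂ a ≠ t • Sum.elim F₁ F₂ b)
    (hdist : ∀ i j m n : Fin (d - 2 + 2),
      planeOf (F₁ i) ⊓ planeOf (F₂ j) = planeOf (F₁ m) ⊓ planeOf (F₂ n) → i = m ∧ j = n) :
    ∀ i, ca i ≠ 0 ∧ cd i ≠ 0 ∧ cf i ≠ 0 ∧ cg i ≠ 0 := by
  have hne (j : Fin 4) : (Pi.single j 1 : Fin 4 → k) ≠ 0 := by simp
  have hfdef' := hfdef.trans (add_comm _ _)
  intro i
  refine ⟨fun h => hf.eval_ne_zero hfdef (hne 0) ?_ ?_ ?_ ?_,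
    fun h => hf.eval_ne_zero hfdef (hne 3) ?_ ?_ ?_ ?_,
    fun h => hf.eval_ne_zero hfdef' (hne 1) ?_ ?_ ?_ ?_,
    fun h => hf.eval_ne_zero hfdef' (hne 2) ?_ ?_ ?_ ?_⟩
  all_goals first
    | (simp; done)
    | (rw [eval_prod]; exact Finset.prod_eq_zero (Finset.mem_univ i) (by simp [h]))
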